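/- arXiv:2410.21864 — 2 statements merged into one kernel-verified Lean document; each statement's English description precedes it below -/
import Mathlib

section
/- Let d = 331914313984493, K = ℚ(√d), ε > 1 the fundamental unit of O_K = ℤ[(1+√d)/2], and x, y ∈ ℕ with ε = x + y·(1+√d)/2. Then d divides y. (A counterexample to the Ankeny–Artin–Chowla conjecture.) -/
/-- The ring of integers `ℤ[(1+√d)/2]` of `ℚ(√d)` (for `d ≡ 1 mod 4`),
viewed as a subset of `ℝ`. -/
def ringOfInts (d : ℕ) : Set ℝ :=
  {α | ∃ x y : ℤ, α = x + y * ((1 + Real.sqrt d) / 2)}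

/-- `α` is a unit of the subring (given as a subset of `ℝ`) `S`. -/
def IsUnitIn (S : Set ℝ) (α : ℝ) : Prop :=
  α ∈ S ∧ ∃ β ∈ S, α * β = 1

/-- `ε` is the fundamental unit (`> 1`) of `O_K`. -/
def IsFundUnit (d : ℕ) (ε : ℝ) : Prop :=
  IsUnitIn (ringOfInts d) ε ∧ 1 < ε ∧
    ∀ η : ℝ, IsUnitIn (ringOfInts d) η → 1 < η → ε ≤ η

/-- The form `(a,b,c)` represents `±1` at some point with known residues and bounded size. -/
def Good (a b c u0 v0 : ℤ) (m : ℕ) : Prop :=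
  ∃ u v : ℤ, (a * u ^ 2 + b * u * v + c * v ^ 2) ^ 2 = 1 ∧
    334901542810353437 ∣ u - u0 ∧ 334901542810353437 ∣ v - v0 ∧ |u| ≤ 2 ^ m ∧ |v| ≤ 2 ^ m

theorem good_step {a b c u0 v0 : ℤ} {m : ℕ} (h : Good a b c u0 v0 m) (c1 p q r s : ℤ)
    {a' b' c' u1 v1 : ℤ}
    (hc : c = a * c1)
    (h1 : a' * p ^ 2 + b' * p * r + c' * r ^ 2 = a * a)
    (h2 : 2 * a' * p * q + b' * (p * s + q * r) + 2 * c' * r * s = b)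
    (h3 : a' * q ^ 2 + b' * q * s + c' * s ^ 2 = c1)
    (h4 : 334901542810353437 ∣
      p * (u0 ^ 2 - c1 * v0 ^ 2) + q * (2 * a * u0 * v0 + b * v0 ^ 2) - u1)
    (h5 : 334901542810353437 ∣
      r * (u0 ^ 2 - c1 * v0 ^ 2) + s * (2 * a * u0 * v0 + b * v0 ^ 2) - v1)
    (h6 : |a| ≤ 2 ^ 100 ∧ |b| ≤ 2 ^ 100 ∧ |c1| ≤ 2 ^ 100)
    (h7 : |p| ≤ 2 ^ 100 ∧ |q| ≤ 2 ^ 100 ∧ |r| ≤ 2 ^ 100 ∧ |s| ≤ 2 ^ 100) :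
    Good a' b' c' u1 v1 (2 * m + 240) := by
  obtain ⟨u, v, hf, hu, hv, bu, bv⟩ := h
  obtain ⟨ba, bb, bc⟩ := h6
  obtain ⟨bp, bq, br, bs⟩ := h7
  subst hc
  have hu' : (u : ℤ) ≡ u0 [ZMOD 334901542810353437] := (Int.modEq_iff_dvd.mpr hu).symm
  have hv' : (v : ℤ) ≡ v0 [ZMOD 334901542810353437] := (Int.modEq_iff_dvd.mpr hv).symm
  have hU : u ^ 2 - c1 * v ^ 2 ≡ u0 ^ 2 - c1 * v0 ^ 2 [ZMOD 334901542810353437] :=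
    (hu'.pow 2).sub ((hv'.pow 2).mul_left _)
  have hV : 2 * a * u * v + b * v ^ 2 ≡ 2 * a * u0 * v0 + b * v0 ^ 2
      [ZMOD 334901542810353437] :=
    ((hu'.mul_left _).mul hv').add ((hv'.pow 2).mul_left _)
  have key : ∀ x y : ℤ, |x| ≤ 2 ^ 100 → |y| ≤ 2 ^ 100 →
      |x * (u ^ 2 - c1 * v ^ 2) + y * (2 * a * u * v + b * v ^ 2)| ≤ 2 ^ (2 * m + 240) := by
    intro x y hx hy
    have e : (2 : ℤ) ^ (2 * m + 240) = 2 ^ 240 * (2 ^ m) ^ 2 := by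
      rw [pow_add, mul_comm 2 m, pow_mul]; ring
    rw [e]
    generalize (2 : ℤ) ^ m = B at bu bv
    have B0 : 0 ≤ B := (abs_nonneg u).trans bu
    have t1 : |u| ^ 2 ≤ B ^ 2 := by gcongr
    have t2 : |v| ^ 2 ≤ B ^ 2 := by gcongr
    have t3 : |u| * |v| ≤ B ^ 2 := by rw [sq]; gcongr
    have hU1 : |u ^ 2 - c1 * v ^ 2| ≤ B ^ 2 + 2 ^ 100 * B ^ 2 := by
      refine (abs_sub _ _).trans ?_
      rw [abs_mul, abs_pow, abs_pow]; gcongr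
    have hV1 : |2 * a * u * v + b * v ^ 2| ≤ 2 * (2 ^ 100 * B ^ 2) + 2 ^ 100 * B ^ 2 := by
      refine (abs_add_le _ _).trans ?_
      have : 2 * a * u * v = 2 * (a * (u * v)) := by ring
      rw [this, abs_mul, abs_mul, abs_mul, abs_mul, abs_pow, abs_two]; gcongr
    refine (abs_add_le _ _).trans ?_
    rw [abs_mul, abs_mul]
    calc _ ≤ 2 ^ 100 * (B ^ 2 + 2 ^ 100 * B ^ 2)
          + 2 ^ 100 * (2 * (2 ^ 100 * B ^ 2) + 2 ^ 100 * B ^ 2) := by gcongr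
      _ ≤ _ := by nlinarith [sq_nonneg B]
  refine ⟨p * (u ^ 2 - c1 * v ^ 2) + q * (2 * a * u * v + b * v ^ 2),
    r * (u ^ 2 - c1 * v ^ 2) + s * (2 * a * u * v + b * v ^ 2), ?_, ?_, ?_,
    key _ _ bp bq, key _ _ br bs⟩
  · have : a' * (p * (u ^ 2 - c1 * v ^ 2) + q * (2 * a * u * v + b * v ^ 2)) ^ 2
      + b' * (p * (u ^ 2 - c1 * v ^ 2) + q * (2 * a * u * v + b * v ^ 2)) *
        (r * (u ^ 2 - c1 * v ^ 2) + s * (2 * a * u * v + b * v ^ 2))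
      + c' * (r * (u ^ 2 - c1 * v ^ 2) + s * (2 * a * u * v + b * v ^ 2)) ^ 2
      = (a * u ^ 2 + b * u * v + a * c1 * v ^ 2) ^ 2 := by
      linear_combination (u ^ 2 - c1 * v ^ 2) ^ 2 * h1
        + (u ^ 2 - c1 * v ^ 2) * (2 * a * u * v + b * v ^ 2) * h2
        + (2 * a * u * v + b * v ^ 2) ^ 2 * h3
    rw [this, hf]; norm_num
  · have := ((hU.mul_left p).add (hV.mul_left q)).symm.dvd
    have := dvd_add this h4
    rwa [sub_add_sub_cancel] at this
  · have := ((hU.mul_left r).add (hV.mul_left s)).symm.dvd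
    have := dvd_add this h5
    rwa [sub_add_sub_cancel] at this

theorem good0 : Good (-9434593) (18917049183203) (-9482516887569749303) 44555814026260161 44443037834 100 := by
  refine ⟨44555814026260161, 44443037834, ?_, ?_, ?_, ?_, ?_⟩ <;> norm_num [abs_le]

theorem good1 : Good (4695817) (-17261298325275) (15862650731161883299) 161566282335638213 10600924376961693 440 := by
  refine good_step good0 (1005079592471) (305368101106860622) (32448924571283365) (166146741327) (17655030298) ?_ ?_ ?_ ?_ ?_ ?_ ?_ ?_ <;> norm_num [abs_le]

theorem good2 : Good (-4411391) (-18775226608277) (-19977209807055231949) 264932912247064921 43292014262626957 1120 := by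
  refine good_step good1 (3378038524747) (-21072122930754857749) (8247643583562540544) (9902140260485) (-3875704590909) ?_ ?_ ?_ ?_ ?_ ?_ ?_ ?_ <;> norm_num [abs_le]

theorem good3 : Good (-7843249) (28661396430869) (-26184163137211962083) 328951501087335981 103362623093627876 2480 := by
  refine good_step good2 (4528551154739) (-968360127641640639) (467133922905077006) (-529987071167) (255664119759) ?_ ?_ ?_ ?_ ?_ ?_ ?_ ?_ <;> norm_num [abs_le]

theorem good4 : Good (4050337) (8373784864365) (4328051774107712959) 27029391053334061 24466570668683072 5200 := by
  refine good_step good3 (3338433235667) (2064976990778284074) (481050073852502527) (-1997623451881) (-465359620639) ?_ ?_ ?_ ?_ ?_ ?_ ?_ ?_ <;> norm_num [abs_le]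

theorem good5 : Good (-4784219) (-1128921117629) (-66597227755292773) 88387655183462436 22757543425595121 10640 := by
  refine good_step good4 (1068565843807) (-143697586864062943) (-36673977556110359) (1217962547300) (310843989093) ?_ ?_ ?_ ?_ ?_ ?_ ?_ ?_ <;> norm_num [abs_le]

theorem good6 : Good (-265957) (-47238286463) (-2097571577403617) 25943857798012036 241000256932267455 21520 := by
  refine good_step good5 (13920187967) (501476291830994) (-12367129624283) (-5648917333) (139310460) ?_ ?_ ?_ ?_ ?_ ?_ ?_ ?_ <;> norm_num [abs_le]

theorem good7 : Good (-2536487) (1939395897609) (-370715131531396031) 313553593585805677 324604394843026864 43280 := by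
  refine good_step good6 (7886882381) (374389702010064488) (-125064095532683105) (979300505433) (-327133282003) ?_ ?_ ?_ ?_ ?_ ?_ ?_ ?_ <;> norm_num [abs_le]

theorem good8 : Good (186463) (639607513) (548052236063) 1996230564945594 326623593836428973 86800 := by
  refine good_step good7 (146152979113) (-120985296943366) (-18234745668941) (68587378547) (10337399961) ?_ ?_ ?_ ?_ ?_ ?_ ?_ ?_ <;> norm_num [abs_le]

theorem good9 : Good (3252653) (9782191825373) (7354863622715244403) 126106612567063371 188372456643637942 173840 := by
  refine good_step good8 (2939201) (-13360626706554039) (-119391953689246) (8885002948) (79397313) ?_ ?_ ?_ ?_ ?_ ?_ ?_ ?_ <;> norm_num [abs_le]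

theorem good10 : Good (-9434003) (-50033373763327) (-66338183540445309703) 334815438075238388 31191722746371493 347920 := by
  refine good_step good9 (2261189134751) (-787198286138735984) (-363926802537541729) (296859201713) (137239907639) ?_ ?_ ?_ ?_ ?_ ?_ ?_ ?_ <;> norm_num [abs_le]

theorem good11 : Good (-920807) (395647096297) (-42499846459772047) 269781256036450808 61804225480629409 696080 := by
  refine good_step good10 (7031817091901) (32571933162415213) (-9155487327752527) (151605222579) (-42613979564) ?_ ?_ ?_ ?_ ?_ ?_ ?_ ?_ <;> norm_num [abs_le]

theorem good12 : Good (-8145151) (-58043035780607) (-103404897055576150139) 252441857223882232 135866788455870616 1392400 := by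
  refine good_step good11 (46154999321) (-2562274994073612015) (-597787049732515868) (719125834832) (167774384945) ?_ ?_ ?_ ?_ ?_ ?_ ?_ ?_ <;> norm_num [abs_le]

theorem good13 : Good (6837187) (-11868890429113) (5150896122117116987) 272043973067072093 137324423916330878 2785040 := by
  refine good_step good12 (12695270726789) (418443768286816783) (-183045511603738958) (482097749811) (-210890532839) ?_ ?_ ?_ ?_ ?_ ?_ ?_ ?_ <;> norm_num [abs_le]

theorem good14 : Good (3000347) (-2697137684161) (606142530096472831) 75055963649703376 10114082473350412 5570320 := by
  refine good_step good13 (753364815401) (393471251711769219) (-49950389835146690) (875415645986) (-111132268481) ?_ ?_ ?_ ?_ ?_ ?_ ?_ ?_ <;> norm_num [abs_le]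

theorem good15 : Good (-1) (-1) (82978578496123) 170217719834449103 196493273878819856 11140880 := by
  refine good_step good14 (202024142573) (1076910336311908853678929) (-161329069841080180496630) (118221529534658450) (-17710452534362331) ?_ ?_ ?_ ?_ ?_ ?_ ?_ ?_ <;> norm_num [abs_le]

theorem final_unit {v0 : ℤ} {u0 : ℤ} {m : ℕ}
    (h : Good (-1) (-1) 82978578496123 u0 v0 m) (hm : m < 100000000)
    (hv1 : v0 % 331914313984493 = 0) (hv2 : v0 % 1009 ≠ 0) :
    ∃ n : ℕ, n < 1000000000 ∧ ∃ T Y : ℤ, (T ^ 2 - 331914313984493 * Y ^ 2) ^ 2 = 16 ∧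
    331914313984493 ∣ Y ∧ Y ≠ 0 ∧ |T| ≤ 2 ^ n ∧ |Y| ≤ 2 ^ n := by
  obtain ⟨u, v, hf, -, hv, bu, bv⟩ := h
  refine ⟨m + 2, by omega, ?_⟩
  have hle : (2 : ℤ) ^ (m + 2) = 2 ^ m * 4 := by rw [pow_add]; norm_num
  rw [hle]
  generalize (2 : ℤ) ^ m = B at *
  have hB : 0 ≤ B := (abs_nonneg u).trans bu
  rw [abs_le] at bu bv
  refine ⟨2 * u + v, v, ?_, by omega, by omega, ?_, ?_⟩
  · linear_combination 16 * hf
  · rw [abs_le]; constructor <;> linarith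
  · rw [abs_le]; constructor <;> linarith

theorem exists_unit :
    ∃ n : ℕ, n < 1000000000 ∧ ∃ T Y : ℤ, (T ^ 2 - 331914313984493 * Y ^ 2) ^ 2 = 16 ∧
    331914313984493 ∣ Y ∧ Y ≠ 0 ∧ |T| ≤ 2 ^ n ∧ |Y| ≤ 2 ^ n :=
  final_unit good15 (by norm_num) (by norm_num) (by norm_num)

/-- Modular exponentiation by repeated squaring. -/
def powm (p : ℕ) : ℕ → ℕ → ℕ → ℕ
  | 0, _, _ => 1 % p
  | f + 1, a, e => (powm p f (a * a % p) (e / 2)) * (if e % 2 = 1 then a else 1) % p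

theorem powm_eq (p f : ℕ) : ∀ a e : ℕ, e < 2 ^ f → powm p f a e = a ^ e % p := by
  induction f with
  | zero =>
    intro a e he
    obtain rfl : e = 0 := by simpa using he
    simp [powm]
  | succ f ih =>
    intro a e he
    have h2 : e / 2 < 2 ^ f := by rw [pow_succ] at he; omega
    rw [powm, ih _ _ h2]
    have h3 : a ^ e = (a * a) ^ (e / 2) * (if e % 2 = 1 then a else 1) := by
      rw [← sq, ← pow_mul]
      rcases Nat.mod_two_eq_zero_or_one e with h | h
      · rw [if_neg (by omega), mul_one, show 2 * (e / 2) = e by omega]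
      · rw [if_pos h, ← pow_succ, show 2 * (e / 2) + 1 = e by omega]
    rw [h3, Nat.mul_mod, Nat.mod_mod, ← Nat.pow_mod, ← Nat.mul_mod]

theorem powm_one (p a e : ℕ) (h : powm p 50 a e = 1 % p) (he : e < 2 ^ 50) :
    (a : ZMod p) ^ e = 1 := by
  rw [powm_eq p 50 a e he] at h
  have := (ZMod.natCast_eq_natCast_iff' (a ^ e) 1 p).mpr h
  exact_mod_cast this

theorem powm_ne_one (p a e : ℕ) (h : powm p 50 a e ≠ 1 % p) (he : e < 2 ^ 50) :
    (a : ZMod p) ^ e ≠ 1 := by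
  rw [powm_eq p 50 a e he] at h
  intro h1
  apply h
  apply (ZMod.natCast_eq_natCast_iff' (a ^ e) 1 p).mp
  exact_mod_cast h1

theorem prime_P : Nat.Prime 2242664283679 := by
  apply lucas_primality 2242664283679 ((3 : ℕ) : ZMod 2242664283679)
  · exact powm_one _ _ _ (by decide +kernel) (by norm_num)
  · intro q hq hd
    have e : 2242664283679 - 1 = 2 * (3 * (7 * (13 * (13 * (4591 * 68821))))) := by norm_num
    rw [e] at hd
    have p1 : Nat.Prime 4591 := by norm_num
    have p2 : Nat.Prime 68821 := by norm_num
    have h13 : Nat.Prime 13 := by norm_num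
    have h7 : Nat.Prime 7 := by norm_num
    have : q = 2 ∨ q = 3 ∨ q = 7 ∨ q = 13 ∨ q = 4591 ∨ q = 68821 := by
      rw [hq.dvd_mul, hq.dvd_mul, hq.dvd_mul, hq.dvd_mul, hq.dvd_mul, hq.dvd_mul,
        Nat.prime_dvd_prime_iff_eq hq Nat.prime_two, Nat.prime_dvd_prime_iff_eq hq Nat.prime_three,
        Nat.prime_dvd_prime_iff_eq hq h7, Nat.prime_dvd_prime_iff_eq hq h13,
        Nat.prime_dvd_prime_iff_eq hq p1, Nat.prime_dvd_prime_iff_eq hq p2] at hd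
      clear * - hd
      omega
    rcases this with rfl | rfl | rfl | rfl | rfl | rfl <;>
      exact powm_ne_one _ _ _ (by decide +kernel) (by norm_num)

theorem prime_D : Nat.Prime 331914313984493 := by
  apply lucas_primality 331914313984493 ((2 : ℕ) : ZMod 331914313984493)
  · exact powm_one _ _ _ (by decide +kernel) (by norm_num)
  · intro q hq hd
    have e : 331914313984493 - 1 = 2 * (2 * (37 * 2242664283679)) := by norm_num
    rw [e] at hd
    have h37 : Nat.Prime 37 := by norm_num
    have : q = 2 ∨ q = 37 ∨ q = 2242664283679 := by
      rw [hq.dvd_mul, hq.dvd_mul, hq.dvd_mul,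
        Nat.prime_dvd_prime_iff_eq hq Nat.prime_two, Nat.prime_dvd_prime_iff_eq hq h37,
        Nat.prime_dvd_prime_iff_eq hq prime_P] at hd
      clear * - hd
      omega
    rcases this with rfl | rfl | rfl <;>
      exact powm_ne_one _ _ _ (by decide +kernel) (by norm_num)

theorem sqrtD_sq : √(331914313984493 : ℝ) * √(331914313984493 : ℝ) = 331914313984493 :=
  Real.mul_self_sqrt (by norm_num)

theorem irr : Irrational √(331914313984493 : ℝ) := by
  have := prime_D.irrational_sqrt
  exact_mod_cast this

theorem coeff_eq {a b c e : ℤ}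
    (h : (a : ℝ) + b * √(331914313984493 : ℝ) = c + e * √(331914313984493 : ℝ)) :
    a = c ∧ b = e := by
  have hb : b = e := by
    by_contra hne
    have h0 : b - e ≠ 0 := sub_ne_zero.mpr hne
    have h1 : ((b - e : ℤ) : ℝ) ≠ 0 := by exact_mod_cast h0
    have h2 := irr.intCast_mul h0
    apply h2.ne_int (c - a)
    push_cast
    linarith
  subst hb
  refine ⟨?_, rfl⟩
  have : (a : ℝ) = c := by linarith
  exact_mod_cast this

theorem ring_mul {α β : ℝ} (hα : α ∈ ringOfInts 331914313984493)
    (hβ : β ∈ ringOfInts 331914313984493) : α * β ∈ ringOfInts 331914313984493 := by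
  obtain ⟨x, y, rfl⟩ := hα
  obtain ⟨z, w, rfl⟩ := hβ
  refine ⟨x * z + 82978578496123 * (y * w), x * w + y * z + y * w, ?_⟩
  have := sqrtD_sq
  push_cast
  linear_combination (y * w / 4 : ℝ) * this

theorem unit_mul {α β : ℝ} (hα : IsUnitIn (ringOfInts 331914313984493) α)
    (hβ : IsUnitIn (ringOfInts 331914313984493) β) :
    IsUnitIn (ringOfInts 331914313984493) (α * β) := by
  obtain ⟨h1, a, h2, h3⟩ := hα
  obtain ⟨h4, b, h5, h6⟩ := hβ
  exact ⟨ring_mul h1 h4, a * b, ring_mul h2 h5, by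
    linear_combination β * b * h3 + h6⟩

theorem unit_pow {α : ℝ} (hα : IsUnitIn (ringOfInts 331914313984493) α) (k : ℕ) :
    IsUnitIn (ringOfInts 331914313984493) (α ^ k) := by
  induction k with
  | zero =>
    have h1 : (1 : ℝ) ∈ ringOfInts 331914313984493 := ⟨1, 0, by simp⟩
    rw [pow_zero]
    exact ⟨h1, 1, h1, by norm_num⟩
  | succ k ih => rw [pow_succ]; exact unit_mul ih hα

theorem eq_pow {ε η : ℝ} (hε : IsFundUnit 331914313984493 ε)
    (hη : IsUnitIn (ringOfInts 331914313984493) η) (h1 : 1 < η) : ∃ k : ℕ, η = ε ^ k := by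
  obtain ⟨hu, h2, hmin⟩ := hε
  obtain ⟨k, hk1, hk2⟩ := exists_nat_pow_near h1.le h2
  refine ⟨k, ?_⟩
  obtain ⟨he, β, hβ, hm⟩ := hu
  have uβ : IsUnitIn (ringOfInts 331914313984493) β := ⟨hβ, ε, he, by rw [mul_comm]; exact hm⟩
  have u := unit_mul hη (unit_pow uβ k)
  have hmk : ε ^ k * β ^ k = 1 := by rw [← mul_pow, hm, one_pow]
  have ep : 0 < ε ^ k := by positivity
  have e : η = η * β ^ k * ε ^ k := by linear_combination (-η) * hmk
  have h3 := mt (hmin _ u)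
  have lt : η * β ^ k < ε := by
    by_contra! hge
    have : ε * ε ^ k ≤ η * β ^ k * ε ^ k := by gcongr
    rw [← e, ← pow_succ'] at this
    linarith
  have le := h3 (not_le.mpr lt)
  apply le_antisymm _ hk1
  rw [e]
  nlinarith

theorem pow_form (t y : ℤ) (k : ℕ) : ∃ T Y : ℤ,
    ((t : ℝ) + y * √(331914313984493 : ℝ)) ^ k = T + Y * √(331914313984493 : ℝ) ∧
    331914313984493 ∣ T - t ^ k ∧ 331914313984493 ∣ t * Y - k * t ^ k * y := by
  induction k with
  | zero => exact ⟨1, 0, by simp, by simp, by simp⟩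
  | succ k ih =>
    obtain ⟨T, Y, h1, ⟨p, hp⟩, ⟨q, hq⟩⟩ := ih
    refine ⟨T * t + 331914313984493 * (Y * y), T * y + Y * t, ?_, ⟨p * t + Y * y, ?_⟩,
      ⟨p * t * y + q * t, ?_⟩⟩
    · rw [pow_succ, h1]
      have := sqrtD_sq
      push_cast
      linear_combination (Y * y : ℝ) * this
    · linear_combination t * hp
    · push_cast
      linear_combination t * y * hp + t * hq

theorem unit_of_sol {T Y : ℤ} (h : (T ^ 2 - 331914313984493 * Y ^ 2) ^ 2 = 16) :
    IsUnitIn (ringOfInts 331914313984493) (((T : ℝ) + Y * √(331914313984493 : ℝ)) / 2) := by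
  have hs := sqrtD_sq
  have h' : T ^ 2 - 331914313984493 * Y ^ 2 = 4 ∨ T ^ 2 - 331914313984493 * Y ^ 2 = -4 :=
    sq_eq_sq_iff_eq_or_eq_neg.mp (by rw [h]; norm_num)
  have hpar : ∃ c, T = Y + 2 * c := by
    have : Even (T ^ 2 - 331914313984493 * Y ^ 2) := by
      rcases h' with h' | h' <;> rw [h']
      · exact ⟨2, by norm_num⟩
      · exact ⟨-2, by norm_num⟩
    have h2 : Even T ↔ Even Y := by
      have h5 : ¬ Even (331914313984493 : ℤ) := by
        rw [Int.not_even_iff_odd]; exact ⟨165957156992246, by norm_num⟩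
      simpa [Int.even_sub, Int.even_mul, Int.even_pow, h5] using this
    obtain ⟨c, hc⟩ := Int.even_sub.mpr h2
    exact ⟨c, by omega⟩
  obtain ⟨c, rfl⟩ := hpar
  refine ⟨⟨c, Y, ?_⟩, ?_⟩
  · push_cast; ring
  · rcases h' with h' | h'
    · have h'' : (((Y + 2 * c) : ℝ)) ^ 2 - 331914313984493 * (Y : ℝ) ^ 2 = 4 := by exact_mod_cast h'
      refine ⟨((Y : ℝ) + 2 * c - Y * √(331914313984493 : ℝ)) / 2, ⟨Y + c, -Y, ?_⟩, ?_⟩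
      · push_cast; ring
      · push_cast
        linear_combination h'' / 4 - (Y : ℝ) ^ 2 / 4 * hs
    · have h'' : (((Y + 2 * c) : ℝ)) ^ 2 - 331914313984493 * (Y : ℝ) ^ 2 = -4 := by
        exact_mod_cast h'
      refine ⟨-(((Y : ℝ) + 2 * c - Y * √(331914313984493 : ℝ)) / 2), ⟨-(Y + c), Y, ?_⟩, ?_⟩
      · push_cast; ring
      · push_cast
        linear_combination -h'' / 4 + (Y : ℝ) ^ 2 / 4 * hs

theorem size_aux2 {n k : ℕ} (h1 : n < 1000000000) (h2 : 331914313984493 ≤ k) :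
    n + 51 ≤ k := by
  linarith

theorem size_aux (W a b : ℝ) (hW : 0 < W) (ha : a ≤ W) (hb : b ≤ W * 2 ^ 50)
    (hc : W * 2 ^ 51 ≤ (a + b) / 2) : False := by
  norm_num at *
  linarith

/-- The counterexample to the Ankeny–Artin–Chowla conjecture. -/
theorem counterexample_AAC (ε : ℝ) (hε : IsFundUnit 331914313984493 ε)
    (x y : ℕ)
    (hxy : ε = x + y * ((1 + Real.sqrt 331914313984493) / 2)) :
    331914313984493 ∣ y := by
  rcases Nat.eq_zero_or_pos y with rfl | hy
  · exact dvd_zero _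
  obtain ⟨n, hn, T, Y, hN, hD, hY, bT, bY⟩ := exists_unit
  have hs := sqrtD_sq
  have s3 : 3 ≤ √(331914313984493 : ℝ) := Real.le_sqrt_of_sq_le (by norm_num)
  have sD : √(331914313984493 : ℝ) ≤ 2 ^ 50 := by
    rw [Real.sqrt_le_left (by norm_num)]; norm_num
  have irr' := @coeff_eq
  have hcop : ¬ (331914313984493 : ℤ) ∣ 2 * x + y := by
    intro hdvd
    obtain ⟨⟨-, β, ⟨z, w, rfl⟩, hm⟩, -⟩ := hε
    rw [Nat.cast_ofNat, hxy] at hm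
    have := coeff_eq (a := (2 * x + y) * (2 * z + w) + 331914313984493 * (y * w))
      (b := (2 * x + y) * w + y * (2 * z + w)) (c := 4) (e := 0) (by
        push_cast
        linear_combination 4 * hm - (y * w : ℝ) * hs)
    have h4 : (331914313984493 : ℤ) ∣ 4 := by
      rw [← this.1]
      exact dvd_add (hdvd.mul_right _) (dvd_mul_right _ _)
    norm_num at h4
  have pf := pow_form (2 * x + y) y
  have hη := unit_of_sol (T := |T|) (Y := |Y|) (by rw [sq_abs, sq_abs]; exact hN)
  have hY1 : 1 ≤ |Y| := Int.one_le_abs hY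
  have hY1' : (1 : ℝ) ≤ (|Y| : ℤ) := by exact_mod_cast hY1
  have hT0' : (0 : ℝ) ≤ (|T| : ℤ) := by exact_mod_cast abs_nonneg T
  have bT' : ((|T| : ℤ) : ℝ) ≤ 2 ^ n := by exact_mod_cast bT
  have bY' : ((|Y| : ℤ) : ℝ) ≤ 2 ^ n := by exact_mod_cast bY
  have hDY : 331914313984493 ∣ |Y| := (dvd_abs _ _).mpr hD
  generalize |T| = T' at *
  generalize |Y| = Y' at *
  generalize √(331914313984493 : ℝ) = s at *
  have hη1 : 1 < ((T' : ℝ) + Y' * s) / 2 := by nlinarith only [hY1', hT0', s3]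
  obtain ⟨k, hk⟩ := eq_pow hε hη hη1
  have hP : Prime (331914313984493 : ℤ) := by
    exact_mod_cast Nat.prime_iff_prime_int.mp prime_D
  -- comparison of coefficients
  obtain ⟨A, B, h1, -, h3⟩ := pf k
  have e2 : (((2 * x + y : ℤ) : ℝ) + ((y : ℤ) : ℝ) * s) = 2 * ε := by
    rw [hxy]; push_cast; ring
  rw [e2, mul_pow, ← hk] at h1
  have h4 := irr' (a := 2 ^ k * T') (b := 2 ^ k * Y') (c := 2 * A) (e := 2 * B) (by
    push_cast; linear_combination 2 * h1)
  have h5 : (331914313984493 : ℤ) ∣ 2 * B := by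
    rw [← h4.2]; exact hDY.mul_left _
  have h6 : (331914313984493 : ℤ) ∣ B :=
    (hP.dvd_or_dvd h5).resolve_left (by norm_num)
  have h7 : (331914313984493 : ℤ) ∣ k * (2 * x + y) ^ k * y :=
    (dvd_sub_right (h6.mul_left _)).mp h3
  rcases hP.dvd_or_dvd h7 with h8 | h8
  · exfalso
    rcases hP.dvd_or_dvd h8 with h9 | h9
    · -- size
      have h9' : 331914313984493 ∣ k := by exact_mod_cast h9
      have hk0 : k ≠ 0 := by
        intro h0
        rw [h0, pow_zero] at hk
        exact absurd hk hη1.ne'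
      have hkD := Nat.le_of_dvd (Nat.pos_of_ne_zero hk0) h9'
      have y1 : (1 : ℝ) ≤ y := by exact_mod_cast hy
      have x0 : (0 : ℝ) ≤ x := Nat.cast_nonneg x
      have ε2 : 2 ≤ ε := by rw [hxy]; nlinarith only [y1, x0, s3]
      have i1 : (2 : ℝ) ^ k ≤ ε ^ k := pow_le_pow_left₀ (by norm_num) ε2 k
      have i2 : (2 : ℝ) ^ (n + 51) ≤ 2 ^ k := pow_le_pow_right₀ (by norm_num) (size_aux2 hn hkD)
      rw [← hk] at i1
      rw [pow_add] at i2
      have i3 : (Y' : ℝ) * s ≤ 2 ^ n * 2 ^ 50 :=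
        mul_le_mul bY' sD (by linarith only [s3]) (by positivity)
      have i4 : (0 : ℝ) < 2 ^ n := by positivity
      exact size_aux _ _ _ i4 bT' i3 (i2.trans i1)
    · have h10 := hP.dvd_of_dvd_pow h9
      exact hcop h10
  · exact_mod_cast h8
end

section
/- Let d ≥ 2 be squarefree, let N denote the norm on ℚ(√d) given by N(a + b√d) = a² - db², and let ε > 1 be the fundamental unit of O_K. If d ≡ 5 (mod 8) and N(ε) = -1, then d does not satisfy condition (RC), i.e., there exists a conductor f > 1 with |Pic(O_f)| = h(d). -/
/-- The maximal order `O_K = ℤ[(1+√d)/2]` as a subring of `ℝ`. -/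
noncomputable def maxOrder (d : ℕ) : Subring ℝ :=
  Subring.closure {(1 + Real.sqrt d) / 2}

/-- The order `O_f = ℤ + f·O_K` of conductor `f` as a subring of `ℝ`
(for `d ≡ 1 mod 4`). -/
noncomputable def orderOfConductor (d f : ℕ) : Subring ℝ :=
  Subring.closure {(f : ℝ) * ((1 + Real.sqrt d) / 2)}

open scoped nonZeroDivisors
namespace NRC

theorem exists_coprime_rep {A : Type*} [CommRing A] [IsDomain A] (c P1 P2 : Ideal A)
    (h1 : P1 ≠ ⊤) (h2 : P2 ≠ ⊤)
    (hP : ∀ M : Ideal A, c ≤ M → M ≠ ⊤ → M ≤ P1 ∨ M ≤ P2) (X : ClassGroup A) :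
    ∃ (I : (FractionalIdeal A⁰ (FractionRing A))ˣ) (I' : Ideal A),
      (I : FractionalIdeal A⁰ (FractionRing A)) = I' ∧ I' ⊔ c = ⊤ ∧
      ClassGroup.mk (FractionRing A) I = X := by
  obtain ⟨J, hJ⟩ : ∃ J : (FractionalIdeal A⁰ (FractionRing A))ˣ,
      ClassGroup.mk (FractionRing A) J = X := by
    exact ClassGroup.induction (FractionRing A)
      (P := fun X => ∃ J : (FractionalIdeal A⁰ (FractionRing A))ˣ,
        ClassGroup.mk (FractionRing A) J = X) (fun I => ⟨I, rfl⟩) X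
  -- J is the inverse of the ideal
  set V : FractionalIdeal A⁰ (FractionRing A) := Units.val J⁻¹ with hV
  have hVJ : V * (J : FractionalIdeal A⁰ (FractionRing A)) = 1 := by rw [hV]; simp
  have ex : ∀ P : Ideal A, P ≠ ⊤ → ∃ x ∈ V,
      ¬ ∀ j ∈ (J : FractionalIdeal A⁰ (FractionRing A)),
        x * j ∈ (P : FractionalIdeal A⁰ (FractionRing A)) := by
    intro P hPt
    by_contra hcon
    push Not at hcon
    have hle : V * (J : FractionalIdeal A⁰ (FractionRing A)) ≤ P :=
      FractionalIdeal.mul_le.2 hcon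
    rw [hVJ, ← FractionalIdeal.coeIdeal_top, FractionalIdeal.coeIdeal_le_coeIdeal] at hle
    exact hPt (top_le_iff.1 hle)
  obtain ⟨x, hxV, hx1, hx2⟩ : ∃ x ∈ V,
      (¬ ∀ j ∈ (J : FractionalIdeal A⁰ (FractionRing A)),
        x * j ∈ (P1 : FractionalIdeal A⁰ (FractionRing A))) ∧
      (¬ ∀ j ∈ (J : FractionalIdeal A⁰ (FractionRing A)),
        x * j ∈ (P2 : FractionalIdeal A⁰ (FractionRing A))) := by
    obtain ⟨x1, hx1V, hx1⟩ := ex P1 h1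
    obtain ⟨x2, hx2V, hx2⟩ := ex P2 h2
    by_cases h12 : ∀ j ∈ (J : FractionalIdeal A⁰ (FractionRing A)),
        x1 * j ∈ (P2 : FractionalIdeal A⁰ (FractionRing A))
    · by_cases h21 : ∀ j ∈ (J : FractionalIdeal A⁰ (FractionRing A)),
        x2 * j ∈ (P1 : FractionalIdeal A⁰ (FractionRing A))
      · refine ⟨x1 + x2, Submodule.add_mem (V : Submodule A (FractionRing A)) hx1V hx2V, ?_, ?_⟩
        · intro h
          apply hx1
          intro j hj
          have := Submodule.sub_mem ((P1 : FractionalIdeal A⁰ (FractionRing A)) :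
            Submodule A (FractionRing A)) (h j hj) (h21 j hj)
          have e : (x1 + x2) * j - x2 * j = x1 * j := by ring
          rw [e] at this
          exact this
        · intro h
          apply hx2
          intro j hj
          have := Submodule.sub_mem ((P2 : FractionalIdeal A⁰ (FractionRing A)) :
            Submodule A (FractionRing A)) (h j hj) (h12 j hj)
          have e : (x1 + x2) * j - x1 * j = x2 * j := by ring
          rw [e] at this
          exact this
      · exact ⟨x2, hx2V, h21, hx2⟩
    · exact ⟨x1, hx1V, hx1, h12⟩
  have hx0 : x ≠ 0 := by
    rintro rfl
    apply hx1
    intro j _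
    rw [zero_mul]
    exact Submodule.zero_mem ((P1 : FractionalIdeal A⁰ (FractionRing A)) :
            Submodule A (FractionRing A))
  let xu : (FractionRing A)ˣ := Units.mk0 x hx0
  have hle : ((J * toPrincipalIdeal A (FractionRing A) xu : _ˣ) :
      FractionalIdeal A⁰ (FractionRing A)) ≤ 1 := by
    rw [← hVJ, Units.val_mul, coe_toPrincipalIdeal, mul_comm]
    refine mul_le_mul_left ?_ _
    rw [FractionalIdeal.spanSingleton_le_iff_mem]
    exact hxV
  obtain ⟨I', hI'⟩ := FractionalIdeal.le_one_iff_exists_coeIdeal.1 hle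
  have key : ∀ P : Ideal A, I' ≤ P → ∀ j ∈ (J : FractionalIdeal A⁰ (FractionRing A)),
        x * j ∈ (P : FractionalIdeal A⁰ (FractionRing A)) := by
    intro P hIP j hj
    have : (I' : FractionalIdeal A⁰ (FractionRing A)) ≤ P :=
      (FractionalIdeal.coeIdeal_le_coeIdeal _).2 hIP
    apply this
    rw [hI', Units.val_mul, coe_toPrincipalIdeal, mul_comm]
    exact FractionalIdeal.mul_mem_mul (FractionalIdeal.mem_spanSingleton_self _ _) hj
  refine ⟨_, I', hI'.symm, ?_, ?_⟩
  · by_contra hne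
    rcases hP _ le_sup_right hne with h | h
    · exact hx1 (key P1 (le_sup_left.trans h))
    · exact hx2 (key P2 (le_sup_left.trans h))
  · rw [← hJ, eq_comm, ClassGroup.mk_eq_mk]
    exact ⟨xu, rfl⟩

theorem exists_mul {A B : Type*} [CommRing A] [CommRing B] [Algebra A B]
    (C : Ideal B) (hC : ∀ b ∈ C, ∃ a : A, algebraMap A B a = b) (p : Ideal A)
    (y : B) (hy : y ∈ p.map (algebraMap A B)) :
    ∀ t ∈ C, ∃ z ∈ p, algebraMap A B z = y * t := by
  refine Submodule.span_induction (p := fun y _ => ∀ t ∈ C, ∃ z ∈ p, algebraMap A B z = y * t)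
    ?_ ?_ ?_ ?_ hy
  · rintro _ ⟨b, hb, rfl⟩ t ht
    obtain ⟨a, rfl⟩ := hC t ht
    exact ⟨b * a, Ideal.mul_mem_right _ _ hb, by simp⟩
  · intro t _
    exact ⟨0, zero_mem _, by simp⟩
  · intro u v _ _ hu hv t ht
    obtain ⟨z, hz, e⟩ := hu t ht
    obtain ⟨z', hz', e'⟩ := hv t ht
    exact ⟨z + z', add_mem hz hz', by rw [map_add, e, e', add_mul]⟩
  · intro s u _ hu t ht
    obtain ⟨z, hz, e⟩ := hu (s * t) (Ideal.mul_mem_left _ _ ht)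
    exact ⟨z, hz, by rw [e, smul_eq_mul]; ring⟩

theorem comap_map_of_coprime {A B : Type*} [CommRing A] [CommRing B] [Algebra A B]
    (hinj : Function.Injective (algebraMap A B))
    (C : Ideal B) (hC : ∀ b ∈ C, ∃ a : A, algebraMap A B a = b) (p : Ideal A)
    (hp : p ⊔ C.comap (algebraMap A B) = ⊤) :
    (p.map (algebraMap A B)).comap (algebraMap A B) = p := by
  refine le_antisymm ?_ Ideal.le_comap_map
  intro x hx
  obtain ⟨b, hb, t, ht, e⟩ := Submodule.mem_sup.1 ((Ideal.eq_top_iff_one _).1 hp)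
  obtain ⟨z, hz, ez⟩ := exists_mul C hC p _ hx (algebraMap A B t) ht
  have : x = x * b + z := by
    have : z = x * t := hinj (by rw [ez, map_mul])
    rw [this, ← mul_add, e, mul_one]
  rw [this]
  exact add_mem (Ideal.mul_mem_left _ _ hb) hz

theorem map_comap_of_coprime {A B : Type*} [CommRing A] [CommRing B] [Algebra A B]
    (C : Ideal B) (hC : ∀ b ∈ C, ∃ a : A, algebraMap A B a = b) (q : Ideal B)
    (hq : q ⊔ C = ⊤) :
    q.comap (algebraMap A B) ⊔ C.comap (algebraMap A B) = ⊤ ∧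
    (q.comap (algebraMap A B)).map (algebraMap A B) = q := by
  obtain ⟨b, hb, t, ht, e⟩ := Submodule.mem_sup.1 ((Ideal.eq_top_iff_one _).1 hq)
  obtain ⟨t', rfl⟩ := hC t ht
  have hb' : b = algebraMap A B (1 - t') := by
    rw [map_sub, map_one, ← e]; ring
  have hmem : (1 - t') ∈ q.comap (algebraMap A B) := by
    rw [Ideal.mem_comap, ← hb']; exact hb
  constructor
  · rw [Ideal.eq_top_iff_one]
    exact Submodule.mem_sup.2 ⟨1 - t', hmem, t', ht, by ring⟩
  · refine le_antisymm Ideal.map_comap_le ?_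
    intro x hx
    obtain ⟨z, hz⟩ := hC (x * algebraMap A B t') (Ideal.mul_mem_left _ _ ht)
    have hx' : x = x * b + algebraMap A B z := by rw [hz, ← mul_add, e, mul_one]
    rw [hx']
    refine add_mem ?_ ?_
    · rw [hb']
      exact Ideal.mul_mem_left _ _ (Ideal.mem_map_of_mem _ hmem)
    · apply Ideal.mem_map_of_mem
      rw [Ideal.mem_comap, hz]
      exact Ideal.mul_mem_right _ _ hx

theorem principal_of_map {A B : Type*} [CommRing A] [CommRing B] [Algebra A B]
    (hinj : Function.Injective (algebraMap A B))
    (C : Ideal B) (hC : ∀ b ∈ C, ∃ a : A, algebraMap A B a = b) (hCt : C ≠ ⊤)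
    (hmax : ∀ a : A, algebraMap A B a ∉ C → ∃ s, algebraMap A B (a * s - 1) ∈ C)
    (hU : ∀ β : B, Ideal.span {β} ⊔ C = ⊤ → ∃ (u : Bˣ) (a : A), algebraMap A B a = u * β)
    (p : Ideal A) (hp : p ⊔ C.comap (algebraMap A B) = ⊤) (γ : B)
    (hγ : p.map (algebraMap A B) = Ideal.span {γ}) :
    ∃ a : A, p = Ideal.span {a} := by
  have h1 : Ideal.span {γ} ⊔ C = ⊤ := by
    rw [← hγ, Ideal.eq_top_iff_one]
    obtain ⟨b, hb, t, ht, e⟩ := Submodule.mem_sup.1 ((Ideal.eq_top_iff_one _).1 hp)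
    exact Submodule.mem_sup.2 ⟨_, Ideal.mem_map_of_mem _ hb, _, ht, by rw [← map_add, e, map_one]⟩
  obtain ⟨u, a, ha⟩ := hU γ h1
  have h2 : Ideal.span {algebraMap A B a} = Ideal.span {γ} := by
    rw [ha]; exact Ideal.span_singleton_mul_left_unit u.isUnit γ
  have h3 : Ideal.span {a} ⊔ C.comap (algebraMap A B) = ⊤ := by
    by_cases hac : algebraMap A B a ∈ C
    · exfalso
      apply hCt
      rw [← h1, ← h2, eq_comm, sup_eq_right, Ideal.span_singleton_le_iff_mem]
      exact hac
    · obtain ⟨s, hs⟩ := hmax a hac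
      rw [Ideal.eq_top_iff_one]
      exact Submodule.mem_sup.2 ⟨a * s, Ideal.mul_mem_right _ _ (Ideal.mem_span_singleton_self a),
        -(a * s - 1), neg_mem (S := Ideal A) (Ideal.mem_comap.2 hs), by ring⟩
  refine ⟨a, ?_⟩
  rw [← comap_map_of_coprime hinj C hC p hp, ← comap_map_of_coprime hinj C hC _ h3, hγ,
    Ideal.map_span, Set.image_singleton, h2]

theorem card_eq {A B : Type*} [CommRing A] [CommRing B] [IsDomain A] [IsDomain B] [Algebra A B]
    (hinj : Function.Injective (algebraMap A B))
    (C : Ideal B) (hC : ∀ b ∈ C, ∃ a : A, algebraMap A B a = b) (hCt : C ≠ ⊤)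
    (hmax : ∀ a : A, algebraMap A B a ∉ C → ∃ s, algebraMap A B (a * s - 1) ∈ C)
    (hU : ∀ β : B, Ideal.span {β} ⊔ C = ⊤ → ∃ (u : Bˣ) (a : A), algebraMap A B a = u * β)
    (P1 P2 : Ideal B)
    (h1 : P1 ≠ ⊤) (h2 : P2 ≠ ⊤)
    (hP : ∀ M : Ideal B, C ≤ M → M ≠ ⊤ → M ≤ P1 ∨ M ≤ P2) :
    Nat.card (ClassGroup A) = Nat.card (ClassGroup B) := by
  have : FaithfulSMul A B := (faithfulSMul_iff_algebraMap_injective A B).2 hinj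
  have : Module.IsTorsionFree A B := inferInstance
  have hct : C.comap (algebraMap A B) ≠ ⊤ := by
    rw [Ideal.ne_top_iff_one] at hCt ⊢
    simpa using hCt
  have hPA : ∀ M : Ideal A, C.comap (algebraMap A B) ≤ M → M ≠ ⊤ →
      M ≤ C.comap (algebraMap A B) ∨ M ≤ C.comap (algebraMap A B) := by
    intro M hM hMt
    left
    intro a ha
    by_contra hac
    obtain ⟨s, hs⟩ := hmax a hac
    apply hMt
    rw [Ideal.eq_top_iff_one]
    have := sub_mem (Ideal.mul_mem_right s _ ha) (hM (Ideal.mem_comap.2 hs))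
    simpa using this
  refine Nat.card_congr (Equiv.ofBijective (ClassGroup.extendedHom A B) ⟨?_, ?_⟩)
  · rw [injective_iff_map_eq_one]
    intro X hX
    obtain ⟨I, I', hI, hco, rfl⟩ := exists_coprime_rep _ _ _ hct hct hPA X
    rw [ClassGroup.extendedHom_mk] at hX
    have hv : ((Units.map (FractionalIdeal.extendedHom (FractionRing B) B).toMonoidHom I : _ˣ) :
        FractionalIdeal B⁰ (FractionRing B)) = ((I'.map (algebraMap A B) : Ideal B) : _) := by
      rw [← FractionalIdeal.extendedHom_coeIdeal_eq_map (K := FractionRing A), ← hI]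
      rfl
    obtain ⟨γ, hγ0, hγ⟩ := (ClassGroup.mk_eq_one_of_coe_ideal hv).1 hX
    obtain ⟨a, ha⟩ := principal_of_map hinj C hC hCt hmax hU I' hco γ hγ
    rw [ClassGroup.mk_eq_one_of_coe_ideal hI]
    refine ⟨a, ?_, ha⟩
    rintro rfl
    apply I.ne_zero
    rw [hI, ha]
    simp
  · intro X
    obtain ⟨I, I', hI, hco, hX⟩ := exists_coprime_rep _ _ _ h1 h2 hP X
    obtain ⟨K, K', hK, hKco, hKX⟩ := exists_coprime_rep _ _ _ h1 h2 hP X⁻¹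
    obtain ⟨hp, hpm⟩ := map_comap_of_coprime C hC I' hco
    obtain ⟨hq, hqm⟩ := map_comap_of_coprime C hC K' hKco
    set p := I'.comap (algebraMap A B)
    set q := K'.comap (algebraMap A B)
    have hIK : ClassGroup.mk (FractionRing B) (I * K) = 1 := by
      rw [map_mul, hX, hKX, mul_inv_cancel]
    have hv : ((I * K : _ˣ) : FractionalIdeal B⁰ (FractionRing B)) = ((I' * K' : Ideal B) : _) := by
      rw [Units.val_mul, hI, hK, FractionalIdeal.coeIdeal_mul]
    obtain ⟨γ, hγ0, hγ⟩ := (ClassGroup.mk_eq_one_of_coe_ideal hv).1 hIK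
    have hpq : p * q ⊔ C.comap (algebraMap A B) = ⊤ := by
      rw [← Ideal.isCoprime_iff_sup_eq] at hp hq ⊢
      exact hp.mul_left hq
    have hpqm : (p * q).map (algebraMap A B) = Ideal.span {γ} := by
      rw [Ideal.map_mul, hpm, hqm, hγ]
    obtain ⟨a, ha⟩ := principal_of_map hinj C hC hCt hmax hU _ hpq γ hpqm
    have ha0 : a ≠ 0 := by
      rintro rfl
      rw [ha] at hpqm
      simp at hpqm
      exact hγ0 (Ideal.span_singleton_eq_bot.1 hpqm.symm)
    have hu : IsUnit ((p : FractionalIdeal A⁰ (FractionRing A)) * (q : FractionalIdeal A⁰ (FractionRing A))) := by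
      rw [← FractionalIdeal.coeIdeal_mul, ha, FractionalIdeal.coeIdeal_span_singleton]
      have ha1 : algebraMap A (FractionRing A) a ≠ 0 := by simpa using ha0
      exact ⟨toPrincipalIdeal A (FractionRing A) (Units.mk0 _ ha1), by simp⟩
    obtain ⟨U, hUU⟩ := isUnit_of_mul_isUnit_left hu
    refine ⟨ClassGroup.mk _ U, ?_⟩
    rw [ClassGroup.extendedHom_mk, ← hX]
    congr 1
    ext1
    rw [hI, ← hpm, ← FractionalIdeal.extendedHom_coeIdeal_eq_map (K := FractionRing A), ← hUU]
    rfl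

theorem core {A B : Type*} [CommRing A] [CommRing B] [IsDomain A] [IsDomain B] [Algebra A B]
    (hinj : Function.Injective (algebraMap A B)) (w : B) (k m n : ℤ)
    (hw : w * w = w + k) (hrep : ∀ b : B, ∃ x y : ℤ, b = x + y * w)
    (huniq : ∀ x y : ℤ, (x : B) + y * w = 0 → x = 0 ∧ y = 0)
    (hA : ∀ b : B, (∃ a, algebraMap A B a = b) ↔ ∃ x y : ℤ, b = x + 3 * y * w)
    (hN : m ^ 2 + m * n - k * n ^ 2 = -1) :
    Nat.card (ClassGroup A) = Nat.card (ClassGroup B) := by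
  have hu2 : ∀ x y x' y' : ℤ, (x : B) + y * w = x' + y' * w → x = x' ∧ y = y' := by
    intro x y x' y' h
    have := huniq (x - x') (y - y') (by push_cast; linear_combination h)
    omega
  have h3 : ∀ x y : ℤ, (x : B) + y * w ∈ Ideal.span {(3 : B)} ↔ (3 ∣ x ∧ 3 ∣ y) := by
    intro x y
    rw [Ideal.mem_span_singleton]
    constructor
    · rintro ⟨c, hc⟩
      obtain ⟨p, q, rfl⟩ := hrep c
      have := hu2 x y (3 * p) (3 * q) (by push_cast; linear_combination hc)
      exact ⟨⟨p, this.1⟩, ⟨q, this.2⟩⟩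
    · rintro ⟨⟨p, rfl⟩, ⟨q, rfl⟩⟩
      exact ⟨p + q * w, by push_cast; ring⟩
  have hCt : Ideal.span {(3 : B)} ≠ ⊤ := by
    rw [Ideal.ne_top_iff_one]
    intro h
    have := (h3 1 0).1 (by simpa using h)
    omega
  have hC : ∀ b ∈ Ideal.span {(3 : B)}, ∃ a : A, algebraMap A B a = b := by
    intro b hb
    obtain ⟨x, y, rfl⟩ := hrep b
    obtain ⟨-, ⟨q, rfl⟩⟩ := (h3 x y).1 hb
    exact (hA _).2 ⟨x, q, by push_cast; ring⟩
  have hmax : ∀ a : A, algebraMap A B a ∉ Ideal.span {(3 : B)} →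
      ∃ s, algebraMap A B (a * s - 1) ∈ Ideal.span {(3 : B)} := by
    intro a ha
    obtain ⟨x, y, hxy⟩ := (hA _).1 ⟨a, rfl⟩
    refine ⟨(x : A), ?_⟩
    have e : algebraMap A B (a * x - 1) = ((x * x - 1 : ℤ) : B) + ((3 * y * x : ℤ) : B) * w := by
      rw [map_sub, map_mul, hxy]; push_cast
      simp
      ring
    rw [e, h3]
    have hx : ¬ (3 ∣ x) := by
      intro hx
      apply ha
      have : algebraMap A B a = (x : B) + ((3 * y : ℤ) : B) * w := by rw [hxy]; push_cast; ring
      rw [this, h3]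
      exact ⟨hx, ⟨y, rfl⟩⟩
    refine ⟨?_, ⟨y * x, by ring⟩⟩
    have h : x % 3 = 1 ∨ x % 3 = 2 := by omega
    apply Int.dvd_of_emod_eq_zero
    rcases h with h | h <;> simp [Int.sub_emod, Int.mul_emod, h]
  -- elements of proper ideals containing 3 have norm divisible by 3
  have hnm : ∀ x y : ℤ, Ideal.span {(x : B) + y * w} ⊔ Ideal.span {(3 : B)} ≠ ⊤ →
      3 ∣ x ^ 2 + x * y - k * y ^ 2 := by
    intro x y h
    by_contra hn
    apply h
    rw [Ideal.eq_top_iff_one]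
    have hco : IsCoprime (3 : ℤ) (x ^ 2 + x * y - k * y ^ 2) :=
      (Prime.coprime_iff_not_dvd Int.prime_three).2 hn
    obtain ⟨r, s, hrs⟩ := hco
    refine Submodule.mem_sup.2 ⟨_, Ideal.mul_mem_left _ (s * ((x : B) + y - y * w))
      (Ideal.mem_span_singleton_self _), _,
      Ideal.mul_mem_left _ (r : B) (Ideal.mem_span_singleton_self _), ?_⟩
    have := congrArg (Int.cast : ℤ → B) hrs
    push_cast at this
    linear_combination this - s * y ^ 2 * hw
  have hnm' : ∀ x y : ℤ, Ideal.span {(x : B) + y * w} ⊔ Ideal.span {(3 : B)} = ⊤ →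
      ¬ 3 ∣ x ^ 2 + x * y - k * y ^ 2 := by
    rintro x y h ⟨N, hNN⟩
    obtain ⟨b, hb, t, ht, e⟩ := Submodule.mem_sup.1 ((Ideal.eq_top_iff_one _).1 h)
    obtain ⟨s, rfl⟩ := Ideal.mem_span_singleton.1 hb
    obtain ⟨t, rfl⟩ := Ideal.mem_span_singleton.1 ht
    have hNN' := congrArg (Int.cast : ℤ → B) hNN
    push_cast at hNN'
    have h1 : ((x + y : ℤ) : B) + ((-y : ℤ) : B) * w ∈ Ideal.span {(3 : B)} := by
      rw [Ideal.mem_span_singleton]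
      refine ⟨N * s + t * (x + y - y * w), ?_⟩
      push_cast
      linear_combination s * hNN' - (x + y - y * w) * e - s * y ^ 2 * hw
    rw [h3] at h1
    have h2 : (x : B) + y * w ∈ Ideal.span {(3 : B)} := by
      rw [h3]; omega
    apply hCt
    rw [← h, eq_comm, sup_eq_right, Ideal.span_singleton_le_iff_mem]
    exact h2
  have hU : ∀ β : B, Ideal.span {β} ⊔ Ideal.span {(3 : B)} = ⊤ →
      ∃ (u : Bˣ) (a : A), algebraMap A B a = u * β := by
    intro β hβ
    obtain ⟨x, y, rfl⟩ := hrep β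
    have hxy := hnm' x y hβ
    have hN' := congrArg (Int.cast : ℤ → B) hN
    push_cast at hN'
    let ε : Bˣ := ⟨m + n * w, -(m + n - n * w),
      by linear_combination -hN' + n ^ 2 * hw, by linear_combination -hN' + n ^ 2 * hw⟩
    have hε : (ε : B) = m + n * w := rfl
    -- multiplication by ε on coordinates
    have hmul : ∀ x y : ℤ, (ε : B) * ((x : B) + y * w) =
        ((m * x + k * n * y : ℤ) : B) + ((n * x + m * y + n * y : ℤ) : B) * w := by
      intro x y
      rw [hε]; push_cast
      linear_combination n * y * hw
    have fin : ∀ (u : Bˣ) (p q : ℤ), (u : B) * ((x : B) + y * w) = p + q * w → 3 ∣ q →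
        ∃ (u : Bˣ) (a : A), algebraMap A B a = u * ((x : B) + y * w) := by
      rintro u p q h ⟨q', rfl⟩
      obtain ⟨a, ha⟩ := (hA ((u : B) * ((x : B) + y * w))).2 ⟨p, q', by rw [h]; push_cast; ring⟩
      exact ⟨u, a, ha⟩
    have dec : ∀ k m n x y : ZMod 3, m ^ 2 + m * n - k * n ^ 2 = -1 →
        x ^ 2 + x * y - k * y ^ 2 ≠ 0 →
        y = 0 ∨ n * x + m * y + n * y = 0 ∨
        n * (m * x + k * n * y) + m * (n * x + m * y + n * y) + n * (n * x + m * y + n * y) = 0 ∨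
        n * (m * (m * x + k * n * y) + k * n * (n * x + m * y + n * y)) +
          m * (n * (m * x + k * n * y) + m * (n * x + m * y + n * y) +
            n * (n * x + m * y + n * y)) +
          n * (n * (m * x + k * n * y) + m * (n * x + m * y + n * y) +
            n * (n * x + m * y + n * y)) = 0 := by
      decide
    have d1 : ((m : ZMod 3) ^ 2 + m * n - k * n ^ 2) = -1 := by exact_mod_cast congrArg (Int.cast : ℤ → ZMod 3) hN
    have d2 : ((x : ZMod 3) ^ 2 + x * y - k * y ^ 2) ≠ 0 := by
      intro h
      apply hxy
      have := (ZMod.intCast_zmod_eq_zero_iff_dvd (x ^ 2 + x * y - k * y ^ 2) 3).1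
        (by push_cast; exact h)
      exact_mod_cast this
    have cv : ∀ z : ℤ, (z : ZMod 3) = 0 → 3 ∣ z := by
      intro z hz
      exact_mod_cast (ZMod.intCast_zmod_eq_zero_iff_dvd z 3).1 hz
    rcases dec _ _ _ _ _ d1 d2 with h | h | h | h
    · exact fin 1 x y (by simp) (cv _ h)
    · exact fin ε _ _ (hmul x y) (cv _ (by push_cast; exact h))
    · exact fin (ε * ε) _ _ (by rw [Units.val_mul, mul_assoc, hmul, hmul])
        (cv _ (by push_cast; exact h))
    · exact fin (ε * (ε * ε)) _ _ (by rw [Units.val_mul, Units.val_mul, mul_assoc, mul_assoc,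
        hmul, hmul, hmul]) (cv _ (by push_cast; exact h))
  have hk : k % 3 = 0 ∨ k % 3 = 1 := by
    have dec : ∀ k m n : ZMod 3, m ^ 2 + m * n - k * n ^ 2 = -1 → k = 0 ∨ k = 1 := by decide
    have d1 : ((m : ZMod 3) ^ 2 + m * n - k * n ^ 2) = -1 := by exact_mod_cast congrArg (Int.cast : ℤ → ZMod 3) hN
    rcases dec _ _ _ d1 with h | h
    · have := (ZMod.intCast_zmod_eq_zero_iff_dvd k 3).1 h
      omega
    · have := (ZMod.intCast_zmod_eq_zero_iff_dvd (k - 1) 3).1 (by push_cast; rw [h]; simp)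
      omega
  have hprop : ∀ M : Ideal B, Ideal.span {(3 : B)} ≤ M → M ≠ ⊤ → ∀ x y : ℤ,
      (x : B) + y * w ∈ M → 3 ∣ x ^ 2 + x * y - k * y ^ 2 := by
    intro M hM hMt x y hxy
    apply hnm
    intro h
    apply hMt
    rw [eq_top_iff, ← h]
    exact sup_le ((Ideal.span_singleton_le_iff_mem _).2 hxy) hM
  rcases hk with hk | hk
  · -- split case
    obtain ⟨k', rfl⟩ : 3 ∣ k := Int.dvd_of_emod_eq_zero hk
    push_cast at hw
    have hP1 : Ideal.span {(3 : B), w} ≠ ⊤ := by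
      rw [Ideal.ne_top_iff_one, Ideal.mem_span_pair]
      rintro ⟨a, b, hab⟩
      have : ((-1 : ℤ) : B) + ((1 : ℤ) : B) * w ∈ Ideal.span {(3 : B)} := by
        rw [Ideal.mem_span_singleton]
        refine ⟨a * (w - 1) + b * k', ?_⟩
        push_cast
        linear_combination (1 - w) * hab + b * hw
      rw [h3] at this
      omega
    have hP2 : Ideal.span {(3 : B), w - 1} ≠ ⊤ := by
      rw [Ideal.ne_top_iff_one, Ideal.mem_span_pair]
      rintro ⟨a, b, hab⟩
      have : ((0 : ℤ) : B) + ((1 : ℤ) : B) * w ∈ Ideal.span {(3 : B)} := by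
        rw [Ideal.mem_span_singleton]
        refine ⟨a * w + b * k', ?_⟩
        push_cast
        linear_combination (- w) * hab + b * hw
      rw [h3] at this
      omega
    refine card_eq hinj _ hC hCt hmax hU _ _ hP1 hP2 ?_
    intro M hM hMt
    have : (M : Set B) ⊆ (Ideal.span {(3 : B), w} : Ideal B) ∪ (Ideal.span {(3 : B), w - 1} : Ideal B) := by
      intro b hb
      obtain ⟨x, y, rfl⟩ := hrep b
      have h := hprop M hM hMt x y hb
      have h' : (3 : ℤ) ∣ x * (x + y) := by
        obtain ⟨z, hz⟩ := h
        exact ⟨z + k' * y ^ 2, by linear_combination hz⟩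
      rcases Int.prime_three.dvd_or_dvd h' with ⟨z, hz⟩ | ⟨z, hz⟩
      · left
        rw [SetLike.mem_coe, Ideal.mem_span_pair]
        exact ⟨z, y, by rw [hz]; push_cast; ring⟩
      · right
        rw [SetLike.mem_coe, Ideal.mem_span_pair]
        have := congrArg (Int.cast : ℤ → B) hz
        push_cast at this
        exact ⟨z, y, by linear_combination -this⟩
    exact Ideal.subset_union.1 this
  · -- inert case
    refine card_eq hinj _ hC hCt hmax hU _ _ hCt hCt ?_
    intro M hM hMt
    left
    intro b hb
    obtain ⟨x, y, rfl⟩ := hrep b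
    have h := hprop M hM hMt x y hb
    rw [h3]
    have d2 : ((x : ZMod 3) ^ 2 + x * y - k * y ^ 2) = 0 := by
      have := (ZMod.intCast_zmod_eq_zero_iff_dvd (x ^ 2 + x * y - k * y ^ 2) 3).2
        (by exact_mod_cast h)
      push_cast at this
      exact this
    have hk1 : (k : ZMod 3) = 1 := by
      have := (ZMod.intCast_zmod_eq_zero_iff_dvd (k - 1) 3).2 (by omega)
      push_cast at this
      exact sub_eq_zero.1 this
    rw [hk1] at d2
    have dec : ∀ x y : ZMod 3, x ^ 2 + x * y - 1 * y ^ 2 = 0 → x = 0 ∧ y = 0 := by decide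
    obtain ⟨e1, e2⟩ := dec _ _ d2
    exact ⟨by exact_mod_cast (ZMod.intCast_zmod_eq_zero_iff_dvd x 3).1 e1,
      by exact_mod_cast (ZMod.intCast_zmod_eq_zero_iff_dvd y 3).1 e2⟩

theorem mem_closure_iff (θ : ℝ) (p q : ℤ) (h : θ * θ = p * θ + q) (z : ℝ) :
    z ∈ Subring.closure {θ} ↔ ∃ x y : ℤ, z = x + y * θ := by
  constructor
  · intro hz
    induction hz using Subring.closure_induction with
    | mem a ha => exact ⟨0, 1, by rw [Set.mem_singleton_iff.1 ha]; simp⟩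
    | zero => exact ⟨0, 0, by simp⟩
    | one => exact ⟨1, 0, by simp⟩
    | add a b _ _ ha hb =>
      obtain ⟨x, y, rfl⟩ := ha
      obtain ⟨x', y', rfl⟩ := hb
      exact ⟨x + x', y + y', by push_cast; ring⟩
    | neg a _ ha =>
      obtain ⟨x, y, rfl⟩ := ha
      exact ⟨-x, -y, by push_cast; ring⟩
    | mul a b _ _ ha hb =>
      obtain ⟨x, y, rfl⟩ := ha
      obtain ⟨x', y', rfl⟩ := hb
      exact ⟨x * x' + y * y' * q, x * y' + y * x' + y * y' * p, by
        push_cast; linear_combination y * y' * h⟩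
  · rintro ⟨x, y, rfl⟩
    exact add_mem (intCast_mem _ x) (mul_mem (intCast_mem _ y)
      (Subring.subset_closure (Set.mem_singleton θ)))

theorem irr (d : ℕ) (hd8 : d % 8 = 5) : Irrational (Real.sqrt d) := by
  rw [irrational_sqrt_natCast_iff]
  rintro ⟨r, hr⟩
  have h8 : r % 8 < 8 := Nat.mod_lt _ (by norm_num)
  rw [hr, Nat.mul_mod] at hd8
  interval_cases r % 8 <;> omega

theorem final (R O : Subring ℝ) (hle : R ≤ O) (w : ℝ) (k m n : ℤ) (hw : w * w = w + k)
    (hO : ∀ z, z ∈ O ↔ ∃ x y : ℤ, z = x + y * w)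
    (hR : ∀ z, z ∈ R ↔ ∃ x y : ℤ, z = x + y * (3 * w))
    (hun : ∀ x y : ℤ, (x : ℝ) + y * w = 0 → x = 0 ∧ y = 0)
    (hN : m ^ 2 + m * n - k * n ^ 2 = -1) :
    Nat.card (ClassGroup R) = Nat.card (ClassGroup O) := by
  let _ : Algebra (R) (O) := (Subring.inclusion hle).toAlgebra
  have hmap : ∀ z : R,
      ((algebraMap (R) (O) z : O) : ℝ) = z := fun z => rfl
  have h3 : ((3 : O) : ℝ) = 3 := rfl
  have hwm : w ∈ O := (hO w).2 ⟨0, 1, by simp⟩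
  refine NRC.core (A := R) (B := O) ?_ ⟨w, hwm⟩ k m n ?_ ?_ ?_ ?_ hN
  · intro x y hxy
    apply Subtype.ext
    rw [← hmap, ← hmap, hxy]
  · apply Subtype.ext
    push_cast
    exact hw
  · intro z
    obtain ⟨x, y, h⟩ := (hO _).1 z.2
    exact ⟨x, y, Subtype.ext (by push_cast; exact h)⟩
  · intro x y h
    have h' := congrArg (Subtype.val : O → ℝ) h
    push_cast at h'
    exact hun x y h'
  · intro z
    constructor
    · rintro ⟨r, rfl⟩
      obtain ⟨x, y, h⟩ := (hR _).1 r.2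
      refine ⟨x, y, Subtype.ext ?_⟩
      rw [hmap, h]
      push_cast
      rw [h3]
      ring
    · rintro ⟨x, y, rfl⟩
      refine ⟨⟨x + y * (3 * w), (hR _).2 ⟨x, y, rfl⟩⟩, Subtype.ext ?_⟩
      rw [hmap]
      push_cast
      rw [h3]
      ring

end NRC

/-- If `d ≡ 5 (mod 8)` and `N(ε) = -1`, then `d` fails condition (RC):
some non-maximal order `O_f` (`f > 1`) has Picard (class) group of the same
cardinality `h(d)` as that of `O_K`. -/
theorem not_RC_of_norm_neg_one (d : ℕ) (hd : 2 ≤ d) (hsf : Squarefree d)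
    (hd8 : d % 8 = 5) (ε : ℝ) (hε : IsFundUnit d ε) (a b : ℚ)
    (hab : ε = a + b * Real.sqrt d)
    (hnorm : a ^ 2 - d * b ^ 2 = -1) :
    ∃ f : ℕ, 1 < f ∧
      Nat.card (ClassGroup (orderOfConductor d f)) =
        Nat.card (ClassGroup (maxOrder d)) := by
  refine ⟨3, by norm_num, ?_⟩
  have hirr : Irrational (Real.sqrt d) := by
    exact NRC.irr d hd8
  have hsq : Real.sqrt d * Real.sqrt d = d := Real.mul_self_sqrt (by positivity)
  have huq : ∀ p q : ℚ, (p : ℝ) + q * Real.sqrt d = 0 → p = 0 ∧ q = 0 := by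
    intro p q h
    have hq : q = 0 := by
      by_contra hq
      apply hirr
      refine ⟨-p / q, ?_⟩
      have hq' : (q : ℝ) ≠ 0 := by exact_mod_cast hq
      push_cast
      field_simp
      linear_combination -h
    subst hq
    refine ⟨?_, rfl⟩
    simpa using h
  obtain ⟨k, hk⟩ : ∃ k : ℤ, (d : ℤ) = 4 * k + 1 := ⟨d / 4, by omega⟩
  have hkR : (d : ℝ) = 4 * k + 1 := by exact_mod_cast congrArg (Int.cast : ℤ → ℝ) hk
  have hkQ : (d : ℚ) = 4 * k + 1 := by exact_mod_cast congrArg (Int.cast : ℤ → ℚ) hk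
  set w : ℝ := (1 + Real.sqrt d) / 2 with hwdef
  have hw : w * w = w + k := by
    rw [hwdef]; linear_combination (1 / 4) * hsq + (1 / 4) * hkR
  have hO : ∀ z, z ∈ maxOrder d ↔ ∃ x y : ℤ, z = x + y * w := fun z =>
    NRC.mem_closure_iff w 1 k (by push_cast; linear_combination hw) z
  have hR : ∀ z, z ∈ orderOfConductor d 3 ↔ ∃ x y : ℤ, z = x + y * (3 * w) := fun z => by
    have := NRC.mem_closure_iff (((3 : ℕ) : ℝ) * w) 3 (9 * k)
      (by push_cast; linear_combination 9 * hw) z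
    push_cast at this
    rw [← this]
    simp [orderOfConductor, hwdef]
  have hle : orderOfConductor d 3 ≤ maxOrder d := by
    intro z hz
    obtain ⟨x, y, rfl⟩ := (hR z).1 hz
    exact (hO _).2 ⟨x, 3 * y, by push_cast; ring⟩
  obtain ⟨m, n, hmn⟩ := hε.1.1
  have hu := huq (a - (m + n / 2)) (b - n / 2) (by
    push_cast
    linear_combination hmn - hab)
  have hN : m ^ 2 + m * n - k * n ^ 2 = -1 := by
    have ha : a = m + n / 2 := by linarith [hu.1]
    have hb : b = n / 2 := by linarith [hu.2]
    rw [ha, hb, hkQ] at hnorm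
    have : ((m : ℚ) ^ 2 + m * n - k * n ^ 2) = -1 := by linear_combination hnorm
    exact_mod_cast this
  have hun : ∀ x y : ℤ, (x : ℝ) + y * w = 0 → x = 0 ∧ y = 0 := by
    intro x y h'
    have := huq (x + y / 2) (y / 2) (by push_cast; rw [← h', hwdef]; ring)
    have hy : (y : ℚ) = 0 := by linarith [this.2]
    have hx : (x : ℚ) = 0 := by linarith [this.1, this.2]
    exact ⟨by exact_mod_cast hx, by exact_mod_cast hy⟩
  exact NRC.final _ _ hle w k m n hw hO hR hun hN
end
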